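/- arXiv:1508.04080 — 2 statements merged into one kernel-verified Lean document; each statement's English description precedes it below -/
import Mathlib

section
/- (Lemma 2, item i.) Fix α ∈ {0,1}. Consider differentiable functions η_i : [0,∞) → ℝ^N for i ∈ {1,…,n} satisfying: η̇_i = Ψ_i(t) for each leader i ∈ L, and η̇_i = −k_{η_i}(η_i − δ_i) + Φ_{i,1}(t) for each follower i ∈ F with k_{η_i} > 0, where for each i ∈ F, δ_i = α·ζ_{i,1} + (1−α)·ε_i, ε_i(t) = (1/κ_i)·Σ_{j=1}^n a_{ij}·η_j(d_{ij}(t)), and ζ_{i,1},…,ζ_{i,σ_i} : [0,∞) → ℝ^N are differentiable and satisfy the cascade ζ̇_{i,ℓ} = −h_{i,ℓ}(ζ_{i,ℓ} − ζ_{i,ℓ+1}) + Φ_{i,2}^{(ℓ)}(t) for ℓ = 1,…,σ_i−1 and ζ̇_{i,σ_i} = −h_{i,σ_i}(ζ_{i,σ_i} − ε_i) + Φ_{i,2}^{(σ_i)}(t), with all h_{i,ℓ} > 0. Suppose Assumptions 1 and 2 hold. If all perturbations Φ_{i,1}, Φ_{i,2}^{(ℓ)} (i ∈ F) and Ψ_i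 (i ∈ L) are uniformly bounded on [0,∞), then the derivatives ζ̇_{i,ℓ} and η̇_i for all followers i ∈ F, and the containment error η_F + (𝓛₁⁻¹𝓛₂ ⊗ I_N)η_L (where η_F and η_L are the column stacks of the followers' and leaders' states), are uniformly bounded on [0,∞). -/
open Filter Matrix

noncomputable section

/-- In-degree of follower `i`: `κ_i = ∑_j a_{ij}`. Agents are `Fin m ⊕ Fin l`,
followers `Sum.inl`, leaders `Sum.inr`. -/
def kappa {m l : ℕ} (a : Fin m ⊕ Fin l → Fin m ⊕ Fin l → ℝ) (i : Fin m) : ℝ :=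
  ∑ k, a (Sum.inl i) k

/-- The follower-follower block `𝓛₁ = D₁ − A₁` of the Laplacian. -/
def lapOne {m l : ℕ} (a : Fin m ⊕ Fin l → Fin m ⊕ Fin l → ℝ) :
    Matrix (Fin m) (Fin m) ℝ :=
  Matrix.diagonal (kappa a) - Matrix.of (fun i j => a (Sum.inl i) (Sum.inl j))

/-- The follower-leader block `𝓛₂ = −A₂` of the Laplacian. -/
def lapTwo {m l : ℕ} (a : Fin m ⊕ Fin l → Fin m ⊕ Fin l → ℝ) :
    Matrix (Fin m) (Fin l) ℝ :=
  Matrix.of (fun i j => -(a (Sum.inl i) (Sum.inr j)))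

/-- Assumption 1: every follower is reachable from some leader by a directed path. -/
def Assumption1 {m l : ℕ} (a : Fin m ⊕ Fin l → Fin m ⊕ Fin l → ℝ) : Prop :=
  ∀ i : Fin m, ∃ j : Fin l,
    Relation.TransGen (fun x y => 0 < a y x) (Sum.inr j) (Sum.inl i)

/-- The delayed neighborhood average `ε_i(t) = κ_i⁻¹ ∑_j a_{ij} η_j(d_{ij}(t))`. -/
def epsAvg {m l N : ℕ} (a : Fin m ⊕ Fin l → Fin m ⊕ Fin l → ℝ)
    (d : Fin m → Fin m ⊕ Fin l → ℝ → ℝ)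
    (η : Fin m ⊕ Fin l → ℝ → EuclideanSpace ℝ (Fin N)) (i : Fin m) (t : ℝ) :
    EuclideanSpace ℝ (Fin N) :=
  (kappa a i)⁻¹ • ∑ j, a (Sum.inl i) j • η j (d i j t)

/-- The containment error: `i`-th block of `η_F + (𝓛₁⁻¹𝓛₂ ⊗ I_N) η_L`. -/
def centErr {m l N : ℕ} (a : Fin m ⊕ Fin l → Fin m ⊕ Fin l → ℝ)
    (η : Fin m ⊕ Fin l → ℝ → EuclideanSpace ℝ (Fin N)) (i : Fin m) (t : ℝ) :
    EuclideanSpace ℝ (Fin N) :=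
  η (Sum.inl i) t + ∑ j, ((lapOne a)⁻¹ * lapTwo a) i j • η (Sum.inr j) t

/-! ### A first-order filter with bounded input -/

section Filter

variable {E : Type*} [NormedAddCommGroup E] [InnerProductSpace ℝ E]

/-- The state of a stable first-order filter is bounded by its input, its initial condition and
its perturbation. -/
lemma norm_le_of_filter {x u φ : ℝ → E} {k U C T : ℝ} (hk : 0 < k)
    (hx : ∀ t, 0 ≤ t → HasDerivAt x (-k • (x t - u t) + φ t) t)
    (hu : ∀ t ∈ Set.Icc 0 T, ‖u t‖ ≤ U) (hφ : ∀ t, 0 ≤ t → ‖φ t‖ ≤ C) :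
    ∀ t ∈ Set.Icc 0 T, ‖x t‖ ≤ U + (‖x 0‖ + C / k + 1) := by
  intro t ht
  have hT : 0 ≤ T := ht.1.trans ht.2
  have hU : 0 ≤ U := (norm_nonneg _).trans (hu 0 ⟨le_rfl, hT⟩)
  have hC : 0 ≤ C := (norm_nonneg _).trans (hφ 0 le_rfl)
  have hCk : 0 ≤ C / k := by positivity
  set R := U + (‖x 0‖ + C / k + 1) with hR
  have hx0 := norm_nonneg (x 0)
  have hRpos : 0 < R := by linarith
  have hsq : ‖x t‖ ^ 2 ≤ R ^ 2 := by
    refine image_le_of_deriv_right_lt_deriv_boundary (a := 0) (b := T)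
      (f := fun s => ‖x s‖ ^ 2) (f' := fun s => 2 * inner ℝ (x s) (-k • (x s - u s) + φ s))
      (B := fun _ => R ^ 2) (B' := fun _ => 0) ?_ ?_ ?_ ?_ ?_ ht
    · intro s hs
      exact (hx s hs.1).norm_sq.continuousAt.continuousWithinAt
    · intro s hs
      exact (hx s hs.1).norm_sq.hasDerivWithinAt
    · exact pow_le_pow_left₀ hx0 (by linarith) 2
    · intro s
      exact hasDerivAt_const _ _
    · intro s hs hsR
      have hs' : ‖x s‖ = R := by
        have := (sq_eq_sq₀ (norm_nonneg (x s)) hRpos.le).1 hsR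
        exact this
      have h1 : inner ℝ (x s) (u s) ≤ R * U := by
        refine (real_inner_le_norm _ _).trans ?_
        rw [hs']
        exact mul_le_mul_of_nonneg_left (hu s ⟨hs.1, hs.2.le⟩) hRpos.le
      have h2 : inner ℝ (x s) (φ s) ≤ R * C := by
        refine (real_inner_le_norm _ _).trans ?_
        rw [hs']
        exact mul_le_mul_of_nonneg_left (hφ s hs.1) hRpos.le
      have h3 : inner ℝ (x s) (-k • (x s - u s) + φ s)
          = -k * (R ^ 2 - inner ℝ (x s) (u s)) + inner ℝ (x s) (φ s) := by
        rw [inner_add_right, inner_smul_right, inner_sub_right, real_inner_self_eq_norm_sq, hs']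
      have h4 : C = k * (C / k) := by field_simp
      have h5 : 0 < k * R * (R - U - C / k) := by
        have : 0 < R - U - C / k := by linarith
        positivity
      have h6 : k * inner ℝ (x s) (u s) ≤ k * (R * U) := mul_le_mul_of_nonneg_left h1 hk.le
      have h7 : R * C = k * R * (C / k) := by
        field_simp
      simp only [h3]
      nlinarith
  exact le_of_sq_le_sq hsq hRpos.le

/-- Every stage of a cascade of stable first-order filters is bounded by the input of the cascade
up to an additive constant. -/
lemma exists_norm_le_of_cascade {s : ℕ} {z φ : Fin s → ℝ → E} {g : ℝ → E} {h : Fin s → ℝ}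
    (hh : ∀ ℓ, 0 < h ℓ)
    (hz : ∀ (ℓ : Fin s) (t : ℝ), 0 ≤ t → HasDerivAt (z ℓ) (-(h ℓ) • (z ℓ t -
      (if hlt : (ℓ : ℕ) + 1 < s then z ⟨(ℓ : ℕ) + 1, hlt⟩ t else g t)) + φ ℓ t) t)
    (hφ : ∀ ℓ, ∃ C, ∀ t, 0 ≤ t → ‖φ ℓ t‖ ≤ C) (ℓ : Fin s) :
    ∃ K, ∀ T U, (∀ t ∈ Set.Icc 0 T, ‖g t‖ ≤ U) → ∀ t ∈ Set.Icc 0 T, ‖z ℓ t‖ ≤ U + K := by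
  obtain ⟨ℓ, hℓ⟩ := ℓ
  obtain ⟨r, hr⟩ : ∃ r, ℓ + r + 1 = s := ⟨s - ℓ - 1, by omega⟩
  induction r generalizing ℓ with
  | zero =>
    obtain ⟨C, hC⟩ := hφ ⟨ℓ, hℓ⟩
    refine ⟨‖z ⟨ℓ, hℓ⟩ 0‖ + C / h ⟨ℓ, hℓ⟩ + 1, fun T U hU => ?_⟩
    refine norm_le_of_filter (hh _) (fun t ht => ?_) hU hC
    have := hz ⟨ℓ, hℓ⟩ t ht
    rwa [dif_neg (by simp only; omega)] at this
  | succ r ih =>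
    have hlt : ℓ + 1 < s := by omega
    obtain ⟨K, hK⟩ := ih (ℓ + 1) hlt (by omega)
    obtain ⟨C, hC⟩ := hφ ⟨ℓ, hℓ⟩
    refine ⟨K + (‖z ⟨ℓ, hℓ⟩ 0‖ + C / h ⟨ℓ, hℓ⟩ + 1), fun T U hU => ?_⟩
    rw [← add_assoc]
    refine norm_le_of_filter (hh _) (fun t ht => ?_) (hK T U hU) hC
    have := hz ⟨ℓ, hℓ⟩ t ht
    rwa [dif_pos (show ((⟨ℓ, hℓ⟩ : Fin s) : ℕ) + 1 < s from hlt)] at this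

end Filter

/-- Small-gain principle for a weighted maximum norm. -/
lemma exists_bound_of_small_gain {ι E : Type*} [Fintype ι] [NormedAddCommGroup E]
    {e : ι → ℝ → E} {w c K : ι → ℝ}
    (hw : ∀ i, 0 < w i) (hc : ∀ i, 0 < c i)
    (he : ∀ i t, 0 ≤ t → ContinuousAt (e i) t)
    (hgain : ∀ T V, (∀ i, ∀ t ∈ Set.Icc 0 T, ‖e i t‖ ≤ V * w i) →
      ∀ i, ∀ t ∈ Set.Icc 0 T, ‖e i t‖ ≤ (w i - c i) * V + K i) :
    ∃ B, ∀ i t, 0 ≤ t → ‖e i t‖ ≤ B * w i := by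
  refine ⟨∑ i, |K i| / c i, fun i T hT => ?_⟩
  have hmax : ∀ j, ∃ s ∈ Set.Icc 0 T, ∀ t ∈ Set.Icc 0 T, ‖e j t‖ ≤ ‖e j s‖ := fun j =>
    isCompact_Icc.exists_isMaxOn (Set.nonempty_Icc.2 hT)
      (fun t ht => (he j t ht.1).norm.continuousWithinAt)
  choose s hs hsmax using hmax
  obtain ⟨j, -, hj⟩ := Finset.exists_max_image Finset.univ (fun j => ‖e j (s j)‖ / w j)
    ⟨i, Finset.mem_univ i⟩
  set V := ‖e j (s j)‖ / w j with hV
  have hbound : ∀ k, ∀ t ∈ Set.Icc 0 T, ‖e k t‖ ≤ V * w k := fun k t ht =>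
    (hsmax k t ht).trans ((div_le_iff₀ (hw k)).1 (hj k (Finset.mem_univ k)))
  have hVj : V * w j = ‖e j (s j)‖ := div_mul_cancel₀ _ (hw j).ne'
  have hVK : V ≤ |K j| / c j := by
    rw [le_div_iff₀ (hc j)]
    have h1 := hgain T V hbound j (s j) (hs j)
    have h2 := le_abs_self (K j)
    rw [← hVj] at h1
    linarith
  have hsum : |K j| / c j ≤ ∑ i, |K i| / c i :=
    Finset.single_le_sum (f := fun i => |K i| / c i)
      (fun k _ => div_nonneg (abs_nonneg _) (hc k).le) (Finset.mem_univ j)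
  exact (hbound i T ⟨hT, le_rfl⟩).trans
    (mul_le_mul_of_nonneg_right (hVK.trans hsum) (hw i).le)

/-! ### The follower block of the Laplacian -/

section Laplacian

variable {m l : ℕ} {a : Fin m ⊕ Fin l → Fin m ⊕ Fin l → ℝ}

lemma kappa_pos (hann : ∀ k k', 0 ≤ a k k') (hA1 : Assumption1 a) (i : Fin m) :
    0 < kappa a i := by
  obtain ⟨j, hj⟩ := hA1 i
  obtain ⟨k, -, hk⟩ := Relation.TransGen.tail'_iff.1 hj
  exact Finset.sum_pos' (fun k _ => hann _ k) ⟨k, Finset.mem_univ k, hk⟩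

lemma lapOne_mulVec (x : Fin m → ℝ) (i : Fin m) :
    (lapOne a *ᵥ x) i = kappa a i * x i - ∑ k, a (Sum.inl i) (Sum.inl k) * x k := by
  rw [lapOne, Matrix.sub_mulVec, Pi.sub_apply, Matrix.mulVec_diagonal]
  rfl

/-- Minimum principle for the follower block of the Laplacian. -/
lemma nonneg_of_lapOne_mulVec_nonneg (hann : ∀ k k', 0 ≤ a k k') (hA1 : Assumption1 a)
    {x : Fin m → ℝ} (hx : ∀ i, 0 ≤ (lapOne a *ᵥ x) i) (i : Fin m) : 0 ≤ x i := by
  by_contra! hi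
  obtain ⟨i₀, -, hmin⟩ := Finset.exists_min_image Finset.univ x ⟨i, Finset.mem_univ i⟩
  set μ := x i₀ with hμ
  have hμneg : μ < 0 := (hmin i (Finset.mem_univ i)).trans_lt hi
  set X : Fin m ⊕ Fin l → ℝ := Sum.elim x 0 with hX
  have hXge : ∀ y, μ ≤ X y := by
    rintro (k | j)
    · exact hmin k (Finset.mem_univ k)
    · exact hμneg.le
  have hstep : ∀ y k, 0 < a k y → X k = μ → X y = μ := by
    rintro y (k | j) hky hk
    · have hle : ∑ y, a (Sum.inl k) y * (X y - μ) ≤ 0 := by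
        have h1 := hx k
        have hk' : x k = μ := hk
        rw [lapOne_mulVec, hk', kappa, Finset.sum_mul] at h1
        simp only [mul_sub, Finset.sum_sub_distrib, hX]
        rw [Fintype.sum_sum_type (fun y => a (Sum.inl k) y * Sum.elim x 0 y)]
        simp only [Sum.elim_inl, Sum.elim_inr, Pi.zero_apply, mul_zero, Finset.sum_const_zero,
          add_zero]
        linarith
      have hterm := Finset.single_le_sum (f := fun y => a (Sum.inl k) y * (X y - μ))
        (fun y _ => mul_nonneg (hann _ y) (sub_nonneg.2 (hXge y))) (Finset.mem_univ y)
      have h2 : X y - μ ≤ 0 := by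
        by_contra! h3
        have := mul_pos hky h3
        linarith
      linarith [hXge y]
    · exact absurd hk hμneg.ne'
  have hback : ∀ y, Relation.TransGen (fun x y => 0 < a y x) y (Sum.inl i₀) → X y = μ := by
    intro y hy
    induction hy using Relation.TransGen.head_induction_on with
    | single hab => exact hstep _ _ hab rfl
    | head hab _ ih => exact hstep _ _ hab ih
  obtain ⟨j, hj⟩ := hA1 i₀
  exact hμneg.ne' (hback _ hj)

lemma isUnit_det_lapOne (hann : ∀ k k', 0 ≤ a k k') (hA1 : Assumption1 a) :
    IsUnit (lapOne a).det := by
  rw [← Matrix.isUnit_iff_isUnit_det, ← Matrix.mulVec_injective_iff_isUnit]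
  refine (injective_iff_map_eq_zero (lapOne a).mulVecLin).2 fun x hx => ?_
  rw [Matrix.mulVecLin_apply] at hx
  funext i
  have h1 := nonneg_of_lapOne_mulVec_nonneg hann hA1 (x := x) (by simp [hx]) i
  have h2 := nonneg_of_lapOne_mulVec_nonneg hann hA1 (x := -x) (by simp [Matrix.mulVec_neg, hx]) i
  exact le_antisymm (neg_nonneg.1 h2) h1

/-- Positive weights that make the follower block of the Laplacian strictly diagonally
dominant. -/
lemma exists_pos_weights (hann : ∀ k k', 0 ≤ a k k') (hA1 : Assumption1 a) :
    ∃ w : Fin m → ℝ, (∀ i, 0 < w i) ∧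
      ∀ i, ∑ k, a (Sum.inl i) (Sum.inl k) * w k = kappa a i * w i - 1 := by
  have hw : lapOne a *ᵥ ((lapOne a)⁻¹ *ᵥ 1) = 1 := by
    rw [Matrix.mulVec_mulVec, Matrix.mul_nonsing_inv _ (isUnit_det_lapOne hann hA1),
      Matrix.one_mulVec]
  set w := (lapOne a)⁻¹ *ᵥ (1 : Fin m → ℝ) with hwdef
  have hw0 : ∀ i, 0 ≤ w i := nonneg_of_lapOne_mulVec_nonneg hann hA1 (by simp [hw])
  have heq : ∀ i, ∑ k, a (Sum.inl i) (Sum.inl k) * w k = kappa a i * w i - 1 := fun i => by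
    have := lapOne_mulVec (a := a) w i
    rw [hw, Pi.one_apply] at this
    linarith
  refine ⟨w, fun i => ?_, heq⟩
  have h1 : 0 ≤ ∑ k, a (Sum.inl i) (Sum.inl k) * w k :=
    Finset.sum_nonneg fun k _ => mul_nonneg (hann _ _) (hw0 k)
  rw [heq] at h1
  exact pos_of_mul_pos_right (by linarith) (kappa_pos hann hA1 i).le

end Laplacian

/-! ### The reference trajectories spanned by the leaders -/

section Reference

variable {m l N : ℕ} {a : Fin m ⊕ Fin l → Fin m ⊕ Fin l → ℝ}
  {η : Fin m ⊕ Fin l → ℝ → EuclideanSpace ℝ (Fin N)}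

/-- The combination of the leaders' states that each agent should attain. -/
def refState (a : Fin m ⊕ Fin l → Fin m ⊕ Fin l → ℝ)
    (η : Fin m ⊕ Fin l → ℝ → EuclideanSpace ℝ (Fin N)) :
    Fin m ⊕ Fin l → ℝ → EuclideanSpace ℝ (Fin N)
  | Sum.inl i => fun t => -∑ j, ((lapOne a)⁻¹ * lapTwo a) i j • η (Sum.inr j) t
  | Sum.inr j => η (Sum.inr j)

lemma centErr_eq_sub_refState (i : Fin m) (t : ℝ) :
    centErr a η i t = η (Sum.inl i) t - refState a η (Sum.inl i) t := by
  simp [centErr, refState]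

/-- The reference trajectory of a follower is the weighted mean of those of its neighbours. -/
lemma sum_smul_refState (hann : ∀ k k', 0 ≤ a k k') (hA1 : Assumption1 a) (i : Fin m) (t : ℝ) :
    ∑ k, a (Sum.inl i) k • refState a η k t = kappa a i • refState a η (Sum.inl i) t := by
  have hP : lapOne a * ((lapOne a)⁻¹ * lapTwo a) = lapTwo a :=
    Matrix.mul_nonsing_inv_cancel_left _ _ (isUnit_det_lapOne hann hA1)
  set P := (lapOne a)⁻¹ * lapTwo a with hPdef
  have hPij : ∀ j, kappa a i * P i j - ∑ k, a (Sum.inl i) (Sum.inl k) * P k j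
      = -a (Sum.inl i) (Sum.inr j) := fun j => by
    rw [← lapOne_mulVec (fun k => P k j) i]
    exact congrFun (congrFun hP i) j
  rw [Fintype.sum_sum_type]
  simp only [refState, ← hPdef, smul_neg, Finset.smul_sum, smul_smul, Finset.sum_neg_distrib]
  rw [Finset.sum_comm, ← sub_eq_zero, sub_neg_eq_add, neg_add_eq_sub, ← Finset.sum_sub_distrib,
    ← Finset.sum_add_distrib]
  refine Finset.sum_eq_zero fun j _ => ?_
  rw [← Finset.sum_smul, ← sub_smul, ← add_smul]
  have := hPij j
  rw [show a (Sum.inl i) (Sum.inr j) - ∑ k, a (Sum.inl i) (Sum.inl k) * P k j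
    + kappa a i * P i j = 0 by linarith, zero_smul]

lemma exists_hasDerivAt_refState {Ψ : Fin l → ℝ → EuclideanSpace ℝ (Fin N)}
    (hηL : ∀ (j : Fin l) (t : ℝ), 0 ≤ t → HasDerivAt (η (Sum.inr j)) (Ψ j t) t)
    (hΨ : ∀ j, ∃ C, ∀ t, 0 ≤ t → ‖Ψ j t‖ ≤ C) (k : Fin m ⊕ Fin l) :
    ∃ (D : ℝ → EuclideanSpace ℝ (Fin N)) (C : ℝ),
      (∀ t, 0 ≤ t → HasDerivAt (refState a η k) (D t) t) ∧ ∀ t, 0 ≤ t → ‖D t‖ ≤ C := by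
  choose C hC using hΨ
  rcases k with i | j
  · refine ⟨fun t => -∑ j, ((lapOne a)⁻¹ * lapTwo a) i j • Ψ j t,
      ∑ j, ‖((lapOne a)⁻¹ * lapTwo a) i j‖ * C j, fun t ht => ?_, fun t ht => ?_⟩
    · exact (HasDerivAt.fun_sum fun j _ =>
        (hηL j t ht).const_smul (((lapOne a)⁻¹ * lapTwo a) i j)).neg
    · rw [norm_neg]
      refine norm_sum_le_of_le _ fun j _ => ?_
      rw [norm_smul]
      exact mul_le_mul_of_nonneg_left (hC j t ht) (norm_nonneg _)
  · exact ⟨Ψ j, C j, hηL j, hC j⟩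

end Reference

/-- The delayed neighbourhood average deviates from the reference trajectory by at most a strict
contraction of the containment errors, up to an additive constant. -/
lemma exists_norm_epsAvg_sub_refState_le {m l N : ℕ}
    {a : Fin m ⊕ Fin l → Fin m ⊕ Fin l → ℝ}
    (hann : ∀ k k', 0 ≤ a k k') (hA1 : Assumption1 a)
    {d : Fin m → Fin m ⊕ Fin l → ℝ → ℝ} {τ : ℝ}
    {η : Fin m ⊕ Fin l → ℝ → EuclideanSpace ℝ (Fin N)}
    {D : Fin m ⊕ Fin l → ℝ → EuclideanSpace ℝ (Fin N)} {C : Fin m ⊕ Fin l → ℝ}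
    (hD : ∀ k t, 0 ≤ t → HasDerivAt (refState a η k) (D k t) t)
    (hC : ∀ k t, 0 ≤ t → ‖D k t‖ ≤ C k)
    {w : Fin m → ℝ}
    (hw : ∀ i, ∑ k, a (Sum.inl i) (Sum.inl k) * w k = kappa a i * w i - 1) (i : Fin m)
    (hd0 : ∀ k, 0 < a (Sum.inl i) k → ∀ t, 0 ≤ t → 0 ≤ d i k t ∧ d i k t ≤ t)
    (hdτ : ∀ k, 0 < a (Sum.inl i) k → ∀ t, 0 ≤ t → t - d i k t ≤ τ) :
    ∃ M, ∀ T V, (∀ i, ∀ t ∈ Set.Icc 0 T, ‖centErr a η i t‖ ≤ V * w i) →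
      ∀ t ∈ Set.Icc 0 T,
        ‖epsAvg a d η i t - refState a η (Sum.inl i) t‖ ≤ (w i - (kappa a i)⁻¹) * V + M := by
  have hκ := kappa_pos hann hA1 i
  refine ⟨(kappa a i)⁻¹ * ∑ k, a (Sum.inl i) k * (C k * τ), fun T V hV t ht => ?_⟩
  have hsplit : epsAvg a d η i t - refState a η (Sum.inl i) t
      = (kappa a i)⁻¹ • ∑ k, a (Sum.inl i) k • (η k (d i k t) - refState a η k t) := by
    simp only [smul_sub, Finset.sum_sub_distrib]
    rw [sum_smul_refState hann hA1, smul_smul, inv_mul_cancel₀ hκ.ne', one_smul]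
    rfl
  have hterm : ∀ k, ‖a (Sum.inl i) k • (η k (d i k t) - refState a η k t)‖
      ≤ a (Sum.inl i) k * (V * (Sum.elim w 0 : Fin m ⊕ Fin l → ℝ) k)
        + a (Sum.inl i) k * (C k * τ) := by
    intro k
    rw [norm_smul, Real.norm_of_nonneg (hann _ k), ← mul_add]
    rcases (hann (Sum.inl i) k).eq_or_lt with h0 | hpos
    · simp [← h0]
    · refine mul_le_mul_of_nonneg_left ?_ hpos.le
      obtain ⟨hd1, hd2⟩ := hd0 k hpos t ht.1
      have hlip : ‖refState a η k (d i k t) - refState a η k t‖ ≤ C k * τ := by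
        have h1 := (convex_Ici (0 : ℝ)).norm_image_sub_le_of_norm_hasDerivWithin_le
          (fun s hs => (hD k s hs).hasDerivWithinAt) (fun s hs => hC k s hs)
          (Set.mem_Ici.2 ht.1) (Set.mem_Ici.2 hd1)
        refine h1.trans (mul_le_mul_of_nonneg_left ?_
          ((norm_nonneg _).trans (hC k 0 le_rfl)))
        rw [Real.norm_eq_abs, abs_sub_comm, abs_of_nonneg (by linarith)]
        exact hdτ k hpos t ht.1
      have herr : ‖η k (d i k t) - refState a η k (d i k t)‖
          ≤ V * (Sum.elim w 0 : Fin m ⊕ Fin l → ℝ) k := by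
        rcases k with k | j
        · rw [← centErr_eq_sub_refState]
          exact hV k _ ⟨hd1, hd2.trans ht.2⟩
        · simp [refState]
      refine (norm_sub_le_norm_sub_add_norm_sub _ (refState a η k (d i k t)) _).trans ?_
      exact add_le_add herr hlip
  rw [hsplit, norm_smul, Real.norm_of_nonneg (inv_nonneg.2 hκ.le)]
  have hsum := norm_sum_le_of_le Finset.univ fun k _ => hterm k
  have hVw : ∑ k, a (Sum.inl i) k * (V * (Sum.elim w 0 : Fin m ⊕ Fin l → ℝ) k)
      = V * (kappa a i * w i - 1) := by
    rw [← hw i, Fintype.sum_sum_type, Finset.mul_sum]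
    simp only [Sum.elim_inl, Sum.elim_inr, Pi.zero_apply, mul_zero, Finset.sum_const_zero,
      add_zero]
    exact Finset.sum_congr rfl fun k _ => by ring
  rw [Finset.sum_add_distrib, hVw] at hsum
  refine (mul_le_mul_of_nonneg_left hsum (inv_nonneg.2 hκ.le)).trans_eq ?_
  rw [mul_add]
  congr 1
  field_simp

/-- Lemma 2, item i): if the perturbations are uniformly bounded, then the
derivatives of the followers' filter states and position-like states, and the
containment error, are uniformly bounded on `[0,∞)`. -/
theorem stmt3 {m l N : ℕ}
    (a : Fin m ⊕ Fin l → Fin m ⊕ Fin l → ℝ)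
    (ha0 : ∀ k, a k k = 0)
    (hann : ∀ k k', 0 ≤ a k k')
    (haL : ∀ (j : Fin l) (k : Fin m ⊕ Fin l), a (Sum.inr j) k = 0)
    (hA1 : Assumption1 a)
    -- Assumption 2: communication blackouts
    (d : Fin m → Fin m ⊕ Fin l → ℝ → ℝ) (Tstar : ℝ) (hT : 0 < Tstar)
    (hd0 : ∀ i j, 0 < a (Sum.inl i) j → ∀ t, 0 ≤ t → 0 ≤ d i j t ∧ d i j t ≤ t)
    (hdT : ∀ i j, 0 < a (Sum.inl i) j → ∀ t, Tstar ≤ t → t - d i j t ≤ Tstar)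
    -- the states, gains, filter orders and perturbations
    (α : ℝ) (hα : α = 0 ∨ α = 1)
    (η : Fin m ⊕ Fin l → ℝ → EuclideanSpace ℝ (Fin N))
    (kη : Fin m → ℝ) (hkη : ∀ i, 0 < kη i)
    (σ : Fin m → ℕ) (hσ : ∀ i, 0 < σ i)
    (ζ : (i : Fin m) → Fin (σ i) → ℝ → EuclideanSpace ℝ (Fin N))
    (h : (i : Fin m) → Fin (σ i) → ℝ) (hh : ∀ i ℓ, 0 < h i ℓ)
    (Φ1 : Fin m → ℝ → EuclideanSpace ℝ (Fin N))
    (Φ2 : (i : Fin m) → Fin (σ i) → ℝ → EuclideanSpace ℝ (Fin N))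
    (Ψ : Fin l → ℝ → EuclideanSpace ℝ (Fin N))
    -- leaders' dynamics
    (hηL : ∀ (j : Fin l) (t : ℝ), 0 ≤ t → HasDerivAt (η (Sum.inr j)) (Ψ j t) t)
    -- followers' dynamics, with `δ_i = α ζ_{i,1} + (1−α) ε_i`
    (hηF : ∀ (i : Fin m) (t : ℝ), 0 ≤ t →
      HasDerivAt (η (Sum.inl i))
        (-(kη i) • (η (Sum.inl i) t -
            (α • ζ i ⟨0, hσ i⟩ t + (1 - α) • epsAvg a d η i t)) + Φ1 i t) t)
    -- the filter cascade
    (hζ : ∀ (i : Fin m) (ℓ : Fin (σ i)) (t : ℝ), 0 ≤ t →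
      HasDerivAt (ζ i ℓ)
        (-(h i ℓ) • (ζ i ℓ t -
            (if hlt : (ℓ : ℕ) + 1 < σ i then ζ i ⟨(ℓ : ℕ) + 1, hlt⟩ t
              else epsAvg a d η i t)) + Φ2 i ℓ t) t)
    -- uniformly bounded perturbations
    (hΦ1 : ∀ i, ∃ C, ∀ t, 0 ≤ t → ‖Φ1 i t‖ ≤ C)
    (hΦ2 : ∀ i ℓ, ∃ C, ∀ t, 0 ≤ t → ‖Φ2 i ℓ t‖ ≤ C)
    (hΨ : ∀ j, ∃ C, ∀ t, 0 ≤ t → ‖Ψ j t‖ ≤ C) :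
    (∀ (i : Fin m) (ℓ : Fin (σ i)), ∃ C, ∀ t, 0 ≤ t → ‖deriv (ζ i ℓ) t‖ ≤ C) ∧
    (∀ i : Fin m, ∃ C, ∀ t, 0 ≤ t → ‖deriv (η (Sum.inl i)) t‖ ≤ C) ∧
    (∃ C, ∀ t, 0 ≤ t → ∀ i : Fin m, ‖centErr a η i t‖ ≤ C) := by
  have hκ : ∀ i, 0 < kappa a i := kappa_pos hann hA1
  obtain ⟨w, hwpos, hw⟩ := exists_pos_weights hann hA1
  choose D CD hD hCD using exists_hasDerivAt_refState (a := a) hηL hΨ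
  have hdτ : ∀ i j, 0 < a (Sum.inl i) j → ∀ t, 0 ≤ t → t - d i j t ≤ Tstar := by
    intro i j hij t ht
    rcases le_total Tstar t with h1 | h1
    · exact hdT i j hij t h1
    · linarith [(hd0 i j hij t ht).1]
  set r : Fin m → ℝ → EuclideanSpace ℝ (Fin N) := fun i => refState a η (Sum.inl i) with hr
  set g : Fin m → ℝ → EuclideanSpace ℝ (Fin N) := fun i t => epsAvg a d η i t - r i t with hg
  set z : (i : Fin m) → Fin (σ i) → ℝ → EuclideanSpace ℝ (Fin N) :=
    fun i ℓ t => ζ i ℓ t - r i t with hzdef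
  have herr : ∀ i t, centErr a η i t = η (Sum.inl i) t - r i t := centErr_eq_sub_refState
  have hz : ∀ (i : Fin m) (ℓ : Fin (σ i)) (t : ℝ), 0 ≤ t → HasDerivAt (z i ℓ)
      (-(h i ℓ) • (z i ℓ t - (if hlt : (ℓ : ℕ) + 1 < σ i then z i ⟨(ℓ : ℕ) + 1, hlt⟩ t
        else g i t)) + (Φ2 i ℓ t - D (Sum.inl i) t)) t := by
    intro i ℓ t ht
    have h1 := (hζ i ℓ t ht).sub (hD (Sum.inl i) t ht)
    refine h1.congr_deriv ?_
    simp only [hzdef, hg, hr]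
    split_ifs <;> module
  have he : ∀ (i : Fin m) (t : ℝ), 0 ≤ t → HasDerivAt (centErr a η i)
      (-(kη i) • (centErr a η i t - (α • z i ⟨0, hσ i⟩ t + (1 - α) • g i t))
        + (Φ1 i t - D (Sum.inl i) t)) t := by
    intro i t ht
    have h1 := (hηF i t ht).sub (hD (Sum.inl i) t ht)
    rw [show centErr a η i = η (Sum.inl i) - refState a η (Sum.inl i) from funext (herr i)]
    refine h1.congr_deriv ?_
    simp only [hzdef, hg, hr, Pi.sub_apply]
    module
  have hzbound : ∀ i ℓ, ∃ K, ∀ T U, (∀ t ∈ Set.Icc 0 T, ‖g i t‖ ≤ U) →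
      ∀ t ∈ Set.Icc 0 T, ‖z i ℓ t‖ ≤ U + K := fun i =>
    exists_norm_le_of_cascade (hh i) (hz i) fun ℓ => by
      obtain ⟨C, hC⟩ := hΦ2 i ℓ
      exact ⟨C + CD (Sum.inl i), fun t ht =>
        norm_sub_le_of_le (hC t ht) (hCD (Sum.inl i) t ht)⟩
  have hδbound : ∀ i, ∃ K, ∀ T U, (∀ t ∈ Set.Icc 0 T, ‖g i t‖ ≤ U) →
      ∀ t ∈ Set.Icc 0 T, ‖α • z i ⟨0, hσ i⟩ t + (1 - α) • g i t‖ ≤ U + K := by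
    intro i
    rcases hα with rfl | rfl
    · exact ⟨0, fun T U hU t ht => by simpa using hU t ht⟩
    · obtain ⟨K, hK⟩ := hzbound i ⟨0, hσ i⟩
      exact ⟨K, fun T U hU t ht => by simpa using hK T U hU t ht⟩
  have hebound : ∀ i, ∃ K, ∀ T U, (∀ t ∈ Set.Icc 0 T, ‖g i t‖ ≤ U) →
      ∀ t ∈ Set.Icc 0 T, ‖centErr a η i t‖ ≤ U + K := by
    intro i
    obtain ⟨K, hK⟩ := hδbound i
    obtain ⟨C, hC⟩ := hΦ1 i
    refine ⟨K + (‖centErr a η i 0‖ + (C + CD (Sum.inl i)) / kη i + 1), fun T U hU => ?_⟩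
    rw [← add_assoc]
    exact norm_le_of_filter (hkη i) (he i) (hK T U hU) fun t ht =>
      norm_sub_le_of_le (hC t ht) (hCD (Sum.inl i) t ht)
  have hgM : ∀ i, ∃ M, ∀ T V, (∀ i, ∀ t ∈ Set.Icc 0 T, ‖centErr a η i t‖ ≤ V * w i) →
      ∀ t ∈ Set.Icc 0 T, ‖g i t‖ ≤ (w i - (kappa a i)⁻¹) * V + M := fun i =>
    exists_norm_epsAvg_sub_refState_le hann hA1 hD hCD hw i (hd0 i) (hdτ i)
  choose M hM using hgM
  choose Ke hKe using hebound
  obtain ⟨B, hB⟩ := exists_bound_of_small_gain (e := centErr a η) (K := fun i => M i + Ke i)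
    hwpos (fun i => inv_pos.2 (hκ i)) (fun i t ht => (he i t ht).continuousAt)
    (fun T V hV i t ht => (hKe i T _ (hM i T V hV) t ht).trans_eq (add_assoc _ _ _))
  have hgB : ∀ i, ∃ U, ∀ T, ∀ t ∈ Set.Icc 0 T, ‖g i t‖ ≤ U := fun i =>
    ⟨_, fun T => hM i T B fun k t ht => hB k t ht.1⟩
  choose U hU using hgB
  refine ⟨fun i ℓ => ?_, fun i => ?_, ∑ i, |B * w i|, fun t ht i => ?_⟩
  · have hnext : ∃ K, ∀ t, 0 ≤ t → ‖(if hlt : (ℓ : ℕ) + 1 < σ i then z i ⟨(ℓ : ℕ) + 1, hlt⟩ t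
        else g i t)‖ ≤ K := by
      by_cases hlt : (ℓ : ℕ) + 1 < σ i
      · obtain ⟨K, hK⟩ := hzbound i ⟨(ℓ : ℕ) + 1, hlt⟩
        refine ⟨U i + K, fun t ht => ?_⟩
        rw [dif_pos hlt]
        exact hK t (U i) (hU i t) t ⟨ht, le_rfl⟩
      · refine ⟨U i, fun t ht => ?_⟩
        rw [dif_neg hlt]
        exact hU i t t ⟨ht, le_rfl⟩
    obtain ⟨K', hK'⟩ := hnext
    obtain ⟨K, hK⟩ := hzbound i ℓ
    obtain ⟨C, hC⟩ := hΦ2 i ℓ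
    refine ⟨h i ℓ * (U i + K + K') + C, fun t ht => ?_⟩
    rw [(hζ i ℓ t ht).deriv]
    refine norm_add_le_of_le ?_ (hC t ht)
    rw [norm_smul, norm_neg, Real.norm_of_nonneg (hh i ℓ).le]
    refine mul_le_mul_of_nonneg_left ?_ (hh i ℓ).le
    refine le_of_eq_of_le (congrArg norm ?_)
      (norm_sub_le_of_le (hK t (U i) (hU i t) t ⟨ht, le_rfl⟩) (hK' t ht))
    simp only [hzdef, hg]
    split_ifs <;> abel
  · obtain ⟨K, hK⟩ := hδbound i
    obtain ⟨C, hC⟩ := hΦ1 i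
    refine ⟨kη i * (B * w i + (U i + K)) + C, fun t ht => ?_⟩
    rw [(hηF i t ht).deriv]
    refine norm_add_le_of_le ?_ (hC t ht)
    rw [norm_smul, norm_neg, Real.norm_of_nonneg (hkη i).le]
    refine mul_le_mul_of_nonneg_left ?_ (hkη i).le
    refine le_of_eq_of_le (congrArg norm ?_)
      (norm_sub_le_of_le (hB i t ht) (hK t (U i) (hU i t) t ⟨ht, le_rfl⟩))
    simp only [herr, hzdef, hg]
    module
  · exact (hB i t ht).trans ((le_abs_self _).trans
      (Finset.single_le_sum (f := fun i => |B * w i|) (fun k _ => abs_nonneg _)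
        (Finset.mem_univ i)))
end
end

section
/- (Observer error dynamics in the proof of Theorem 3, output feedback.) Let S₁, S₂ ∈ ℝ^{N×N}, k_φ > 0, k_d > 0, k_p > 0, and let p, v, φ, σ, v̂, ψ₁, ψ₂ : [0,∞) → ℝ^N be differentiable functions satisfying ṗ = v, v̇ = S₁p + S₂v + Γ, where Γ = −(k_d·I_N + S₂)(k_φ(φ + p) − v̂) − k_p(p − ψ₁) + 2σ and φ̇ = −(k_φ·I_N − S₂)(p + φ) + (1/k_φ)(Γ + S₁p). Then the error φ̃ := φ + p − (1/k_φ)v satisfies the linear equation φ̃̇ = −(k_φ·I_N − S₂)·φ̃; in particular, if −(k_φ·I_N − S₂) is Hurwitz (all eigenvalues have negative real part), then φ̃(t) → 0 exponentially as t → ∞. -/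
open Filter Matrix

noncomputable section

/-- A solution of `y' = μ y + f` decays at rate `c` if the forcing `f` does and `Re μ < -c`. -/
lemma exists_norm_le_mul_exp_of_hasDerivAt_smul_add {E : Type*} [NormedAddCommGroup E]
    [NormedSpace ℂ E] {c C : ℝ} {μ : ℂ} (hμ : μ.re < -c) {y f : ℝ → E}
    (hy : ∀ t, 0 ≤ t → HasDerivAt y (μ • y t + f t) t)
    (hf : ∀ t, 0 ≤ t → ‖f t‖ ≤ C * Real.exp (-c * t)) :
    ∃ D : ℝ, ∀ t, 0 ≤ t → ‖y t‖ ≤ D * Real.exp (-c * t) := by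
  have ha : 0 < -c - μ.re := by linarith
  set a := -c - μ.re with ha_def
  have hC : 0 ≤ C := by simpa using (norm_nonneg _).trans (hf 0 le_rfl)
  have norm_factor (t : ℝ) : ‖Complex.exp (-μ * t)‖ = Real.exp (-μ.re * t) := by
    simp [Complex.norm_exp]
  have hz : ∀ t : ℝ, 0 ≤ t → HasDerivAt (fun s : ℝ => Complex.exp (-μ * s) • y s)
      (Complex.exp (-μ * t) • f t) t := by
    intro t ht
    have hexp : HasDerivAt (fun s : ℝ => Complex.exp (-μ * s))
        (Complex.exp (-μ * t) * (-μ * 1)) t :=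
      ((Complex.ofRealCLM.hasDerivAt (x := t)).const_mul (-μ)).cexp
    refine (hexp.smul (hy t ht)).congr_deriv ?_
    module
  have hB : ∀ t : ℝ, HasDerivAt (fun s : ℝ => ‖y 0‖ + C / a * (Real.exp (a * s) - 1))
      (C * Real.exp (a * t)) t := by
    intro t
    have := (((((hasDerivAt_id t).const_mul a).exp).sub_const 1).const_mul (C / a)).const_add ‖y 0‖
    refine this.congr_deriv ?_
    simp only [id]
    field_simp
  refine ⟨‖y 0‖ + C / a, fun t ht => ?_⟩
  have key : ‖Complex.exp (-μ * t) • y t‖ ≤ ‖y 0‖ + C / a * (Real.exp (a * t) - 1) := by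
    refine image_norm_le_of_norm_deriv_right_le_deriv_boundary
      (f := fun s : ℝ => Complex.exp (-μ * s) • y s)
      (f' := fun s : ℝ => Complex.exp (-μ * s) • f s) (a := 0) (b := t)
      (fun s hs => (hz s hs.1).continuousAt.continuousWithinAt)
      (fun s hs => (hz s hs.1).hasDerivWithinAt)
      (by simp) hB (fun s hs => ?_) ⟨ht, le_rfl⟩
    rw [norm_smul, norm_factor]
    calc Real.exp (-μ.re * s) * ‖f s‖
        ≤ Real.exp (-μ.re * s) * (C * Real.exp (-c * s)) := by gcongr; exact hf s hs.1
      _ = C * Real.exp (a * s) := by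
        rw [mul_left_comm, ← Real.exp_add, ha_def]; ring_nf
  rw [norm_smul, norm_factor] at key
  have hmono : ‖y 0‖ + C / a * (Real.exp (a * t) - 1) ≤ (‖y 0‖ + C / a) * Real.exp (a * t) := by
    have h1 : 1 ≤ Real.exp (a * t) := Real.one_le_exp (by positivity)
    have h2 : 0 ≤ C / a := by positivity
    nlinarith [norm_nonneg (y 0)]
  calc ‖y t‖ = Real.exp (μ.re * t) * (Real.exp (-μ.re * t) * ‖y t‖) := by
        rw [← mul_assoc, ← Real.exp_add]; simp
    _ ≤ Real.exp (μ.re * t) * ((‖y 0‖ + C / a) * Real.exp (a * t)) := by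
        exact mul_le_mul_of_nonneg_left (key.trans hmono) (Real.exp_nonneg _)
    _ = (‖y 0‖ + C / a) * Real.exp (-c * t) := by
        rw [mul_left_comm, ← Real.exp_add, ha_def]; ring_nf

lemma HasDerivAt.const_mulVec {m n : Type*} [Fintype m] [Fintype n] (M : Matrix m n ℂ)
    {x : ℝ → n → ℂ} {x' : n → ℂ} {t : ℝ} (hx : HasDerivAt x x' t) :
    HasDerivAt (fun s => M.mulVec (x s)) (M.mulVec x') t :=
  (M.mulVecLin.restrictScalars ℝ).toContinuousLinearMap.hasFDerivAt.comp_hasDerivAt t hx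

/-- If `x' = M x` and a product of factors `M - μ` with `Re μ < -c` maps `x` to `0`, then `x`
decays at rate `c`. -/
lemma exists_norm_le_mul_exp_of_aeval_prod_mulVec_eq_zero {n : Type*} [Fintype n] [DecidableEq n]
    (M : Matrix n n ℂ) {c : ℝ} (s : Multiset ℂ) (hs : ∀ μ ∈ s, μ.re < -c) :
    ∀ x : ℝ → n → ℂ, (∀ t, 0 ≤ t → HasDerivAt x (M.mulVec (x t)) t) →
      (∀ t, 0 ≤ t → (Polynomial.aeval M
        (s.map fun μ => Polynomial.X - Polynomial.C μ).prod).mulVec (x t) = 0) →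
      ∃ D : ℝ, ∀ t, 0 ≤ t → ‖x t‖ ≤ D * Real.exp (-c * t) := by
  induction s using Multiset.induction_on with
  | empty =>
    intro x _ h
    exact ⟨0, fun t ht => by simpa using h t ht⟩
  | cons μ s ih =>
    intro x hx h
    obtain ⟨C, hC⟩ := ih (fun ν hν => hs ν (Multiset.mem_cons_of_mem hν))
      (fun t => (M - algebraMap ℂ _ μ).mulVec (x t))
      (fun t ht => by
        refine ((hx t ht).const_mulVec (M - algebraMap ℂ _ μ)).congr_deriv ?_
        rw [Matrix.mulVec_mulVec, Matrix.mulVec_mulVec, mul_sub, sub_mul,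
          Algebra.commutes μ M])
      (fun t ht => by
        have := h t ht
        rwa [Multiset.map_cons, Multiset.prod_cons, mul_comm, map_mul, map_sub,
          Polynomial.aeval_X, Polynomial.aeval_C, ← Matrix.mulVec_mulVec] at this)
    refine exists_norm_le_mul_exp_of_hasDerivAt_smul_add (hs μ (Multiset.mem_cons_self μ s))
      (fun t ht => ?_) hC
    refine (hx t ht).congr_deriv ?_
    simp [Matrix.sub_mulVec, Algebra.algebraMap_eq_smul_one, Matrix.smul_mulVec]

/-- Solutions of `x' = M x` with `M` Hurwitz decay exponentially. -/
lemma exists_norm_le_mul_exp_of_spectrum_re_neg {n : Type*} [Fintype n] [DecidableEq n]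
    (M : Matrix n n ℂ) (hM : ∀ μ ∈ spectrum ℂ M, μ.re < 0) (x : ℝ → n → ℂ)
    (hx : ∀ t, 0 ≤ t → HasDerivAt x (M.mulVec (x t)) t) :
    ∃ C c : ℝ, 0 < c ∧ ∀ t, 0 ≤ t → ‖x t‖ ≤ C * Real.exp (-c * t) := by
  have hroots : ∀ μ ∈ M.charpoly.roots, μ.re < 0 := fun μ hμ =>
    hM μ (Matrix.mem_spectrum_iff_isRoot_charpoly.2 (Polynomial.isRoot_of_mem_roots hμ))
  have hgap : ∀ᶠ c : ℝ in nhdsWithin 0 (Set.Ioi 0),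
      ∀ μ ∈ M.charpoly.roots.toFinset, μ.re < -c := by
    rw [Filter.eventually_all_finset]
    intro μ hμ
    have h0 := hroots μ (Multiset.mem_toFinset.1 hμ)
    filter_upwards [Ioo_mem_nhdsGT (neg_pos.2 h0)] with c hc
    linarith [hc.2]
  obtain ⟨c, hc, hc0⟩ := (hgap.and self_mem_nhdsWithin).exists
  obtain ⟨C, hC⟩ := exists_norm_le_mul_exp_of_aeval_prod_mulVec_eq_zero M M.charpoly.roots
    (fun μ hμ => hc μ (Multiset.mem_toFinset.2 hμ)) x hx (fun t _ => by
      rw [← (IsAlgClosed.splits M.charpoly).eq_prod_roots_of_monic M.charpoly_monic,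
        Matrix.aeval_self_charpoly, Matrix.zero_mulVec])
  exact ⟨C, c, hc0, hC⟩

/-- Solutions of the real system `x' = A x` with `A` Hurwitz decay exponentially. -/
lemma exists_norm_le_mul_exp_of_spectrum_map_re_neg {n : Type*} [Fintype n] [DecidableEq n]
    (A : Matrix n n ℝ) (hA : ∀ μ ∈ spectrum ℂ (A.map (algebraMap ℝ ℂ)), μ.re < 0) (x : ℝ → n → ℝ)
    (hx : ∀ t, 0 ≤ t → HasDerivAt x (A.mulVec (x t)) t) :
    ∃ C c : ℝ, 0 < c ∧ ∀ t, 0 ≤ t → ‖x t‖ ≤ C * Real.exp (-c * t) := by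
  obtain ⟨C, c, hc, h⟩ := exists_norm_le_mul_exp_of_spectrum_re_neg _ hA
    (fun t i => (x t i : ℂ)) (fun t ht => by
      rw [hasDerivAt_pi]
      intro i
      exact (hasDerivAt_pi.1 (hx t ht) i).ofReal_comp.congr_deriv
        (RingHom.map_mulVec (algebraMap ℝ ℂ) A (x t) i))
  refine ⟨C, c, hc, fun t ht => le_of_eq_of_le ?_ (h t ht)⟩
  simp [Pi.norm_def]

/-- Observer error dynamics in the proof of Theorem 3 (output feedback): the
error `φ̃ = φ + p − (1/k_φ)v` satisfies `φ̃̇ = −(k_φ I_N − S₂) φ̃`; in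
particular, if `−(k_φ I_N − S₂)` is Hurwitz then `φ̃(t) → 0` exponentially. -/
theorem stmt18 {N : ℕ} (S1 S2 : Matrix (Fin N) (Fin N) ℝ)
    (kφ kd kp : ℝ) (hkφ : 0 < kφ) (hkd : 0 < kd) (hkp : 0 < kp)
    (p v φ σv vhat ψ1 ψ2 Γ : ℝ → (Fin N → ℝ))
    (hΓ : ∀ t, Γ t =
      -(kd • (1 : Matrix (Fin N) (Fin N) ℝ) + S2).mulVec
          (kφ • (φ t + p t) - vhat t)
        - kp • (p t - ψ1 t) + (2 : ℝ) • σv t)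
    (hp : ∀ t, 0 ≤ t → HasDerivAt p (v t) t)
    (hv : ∀ t, 0 ≤ t → HasDerivAt v
      (S1.mulVec (p t) + S2.mulVec (v t) + Γ t) t)
    (hφ : ∀ t, 0 ≤ t → HasDerivAt φ
      (-(kφ • (1 : Matrix (Fin N) (Fin N) ℝ) - S2).mulVec (p t + φ t)
        + (1 / kφ) • (Γ t + S1.mulVec (p t))) t) :
    (∀ t, 0 ≤ t →
      HasDerivAt (fun s => φ s + p s - (1 / kφ) • v s)
        (-(kφ • (1 : Matrix (Fin N) (Fin N) ℝ) - S2).mulVec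
          (φ t + p t - (1 / kφ) • v t)) t) ∧
    ((∀ μ ∈ spectrum ℂ
        ((-(kφ • (1 : Matrix (Fin N) (Fin N) ℝ) - S2)).map (algebraMap ℝ ℂ)),
        μ.re < 0) →
      ∃ C c : ℝ, 0 < c ∧ ∀ t, 0 ≤ t →
        ‖φ t + p t - (1 / kφ) • v t‖ ≤ C * Real.exp (-c * t)) := by
  have hderiv : ∀ t, 0 ≤ t →
      HasDerivAt (fun s => φ s + p s - (1 / kφ) • v s)
        (-(kφ • (1 : Matrix (Fin N) (Fin N) ℝ) - S2).mulVec
          (φ t + p t - (1 / kφ) • v t)) t := by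
    intro t ht
    refine (((hφ t ht).add (hp t ht)).sub ((hv t ht).const_smul (1 / kφ))).congr_deriv ?_
    have hk : (1 / kφ) • kφ • v t = v t := by
      rw [smul_smul, one_div_mul_cancel hkφ.ne', one_smul]
    simp only [Matrix.sub_mulVec, Matrix.smul_mulVec, Matrix.one_mulVec, Matrix.mulVec_sub,
      Matrix.mulVec_add, Matrix.mulVec_smul, smul_sub, smul_add, hk]
    abel
  refine ⟨hderiv, fun hH => ?_⟩
  exact exists_norm_le_mul_exp_of_spectrum_map_re_neg _ hH _ fun t ht => by
    simpa only [Matrix.neg_mulVec] using hderiv t ht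
end
end
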